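/- arXiv:2207.01230 — 4 statements merged into one kernel-verified Lean document; each statement's English description precedes it below -/
import Mathlib

section
/- Let K, M, N be positive integers, let Q_k ∈ ℂ^{N×M} for k = 1,…,K, let v ∈ ℂ^N, let ε ≥ 0, P ≥ 0, R ∈ ℝ, and for each k let W_k ∈ ℂ^{M×M} be Hermitian positive semidefinite. Set h_k := Q_k^H v and assume for every k ∈ {1,…,K}: (i) h_k^H W_k h_k ≥ R, (ii) ∑_{k'≠k} h_{k'}^H W_k h_{k'} ≤ ε, (iii) ∑_{k=1}^K Tr(W_k) ≤ P, and (iv) h_k^H W_k h_k > 0. Define w̄_k := (h_k^H W_k h_k)^{−1/2} · W_k h_k and W̄_k := w̄_k w̄_k^H. Then for every k: rank(W̄_k) = 1, h_k^H W̄_k h_k = h_k^H W_k h_k ≥ R, ∑_{k'≠k} h_{k'}^H W̄_k h_{k'} ≤ ε, and ∑_{k=1}^K Tr(W̄_k) ≤ P. (Hence an optimal rank-one solution of the max–min beam pattern gain problem can always be constructed from an optimal solution of its semidefinite relaxation.) -/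
open Matrix Finset
open scoped ComplexOrder

lemma aux_symm {M : ℕ} {A : Matrix (Fin M) (Fin M) ℂ} (hA : A.PosSemidef)
    (x y : Fin M → ℂ) : star y ⬝ᵥ (A *ᵥ x) = star (star x ⬝ᵥ (A *ᵥ y)) := by
  rw [Matrix.star_dotProduct, Matrix.star_mulVec, hA.isHermitian.eq,
    ← Matrix.dotProduct_mulVec]

lemma aux_real {M : ℕ} {A : Matrix (Fin M) (Fin M) ℂ} (hA : A.PosSemidef)
    (x : Fin M → ℂ) : star x ⬝ᵥ (A *ᵥ x) = ((star x ⬝ᵥ (A *ᵥ x)).re : ℂ) := by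
  have := aux_symm hA x x
  exact (Complex.conj_eq_iff_re.mp this.symm).symm

lemma aux_cs {M : ℕ} {A : Matrix (Fin M) (Fin M) ℂ} (hA : A.PosSemidef)
    (x y : Fin M → ℂ) (hy : 0 < (star y ⬝ᵥ (A *ᵥ y)).re) :
    Complex.normSq (star x ⬝ᵥ (A *ᵥ y)) ≤
      (star y ⬝ᵥ (A *ᵥ y)).re * (star x ⬝ᵥ (A *ᵥ x)).re := by
  have hs := aux_symm hA x y
  have hx' := aux_real hA x
  have hy' := aux_real hA y
  generalize hg : (star y ⬝ᵥ (A *ᵥ y)).re = g at *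
  generalize ha : (star x ⬝ᵥ (A *ᵥ x)).re = a at *
  generalize ht : star x ⬝ᵥ (A *ᵥ y) = t at *
  have h0 := hA.dotProduct_mulVec_nonneg ((g : ℂ) • x - (star t) • y)
  have h1 : star ((g : ℂ) • x - (star t) • y) ⬝ᵥ (A *ᵥ ((g : ℂ) • x - (star t) • y))
      = ((g * (g * a - Complex.normSq t) : ℝ) : ℂ) := by
    simp only [star_sub, star_smul, mulVec_sub, mulVec_smul, sub_dotProduct, dotProduct_sub,
      smul_dotProduct, dotProduct_smul, smul_eq_mul, hs, hx', hy', ht, star_star]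
    push_cast
    rw [Complex.normSq_eq_conj_mul_self]
    simp only [Complex.star_def, Complex.conj_ofReal]
    ring
  rw [h1] at h0
  have h2 : 0 ≤ g * (g * a - Complex.normSq t) := by exact_mod_cast h0
  have := nonneg_of_mul_nonneg_right h2 hy
  linarith

lemma aux_quad {M : ℕ} (w x : Fin M → ℂ) :
    star x ⬝ᵥ (vecMulVec w (star w) *ᵥ x) = (Complex.normSq (star x ⬝ᵥ w) : ℂ) := by
  have : star w ⬝ᵥ x = star (star x ⬝ᵥ w) := by
    rw [Matrix.star_dotProduct, dotProduct_comm]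
  rw [Matrix.vecMulVec_mulVec, Complex.normSq_eq_conj_mul_self, this]
  simp [dotProduct_smul, mul_comm]

lemma aux_trace {M : ℕ} (A : Matrix (Fin M) (Fin M) ℂ) :
    A.trace.re = ∑ i, (star (Pi.single i (1:ℂ)) ⬝ᵥ (A *ᵥ (Pi.single i (1:ℂ)))).re := by
  simp [Matrix.trace]

/-- Proposition 1 (rank-one reconstruction for the SS sensing semidefinite relaxation):
from a feasible (PSD) solution `{W_k}` of the relaxed problem, the reconstructed rank-one
matrices `W̄_k = w̄_k w̄_kᴴ` with `w̄_k = (h_kᴴ W_k h_k)^{-1/2} W_k h_k` satisfy all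
constraints with the same beam pattern gains. -/
theorem rank_one_reconstruction_SS
    (K M N : ℕ) (hK : 0 < K) (hM : 0 < M) (hN : 0 < N)
    (Q : Fin K → Matrix (Fin N) (Fin M) ℂ) (v : Fin N → ℂ)
    (ε P R : ℝ) (hε : 0 ≤ ε) (hP : 0 ≤ P)
    (W : Fin K → Matrix (Fin M) (Fin M) ℂ)
    (hW : ∀ k, (W k).PosSemidef)
    (h : Fin K → Fin M → ℂ)
    (hdef : ∀ k, h k = (Q k)ᴴ *ᵥ v)
    (hgain : ∀ k, R ≤ (star (h k) ⬝ᵥ ((W k) *ᵥ (h k))).re)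
    (hinterf : ∀ k, ∑ k' ∈ Finset.univ.erase k,
      (star (h k') ⬝ᵥ ((W k) *ᵥ (h k'))).re ≤ ε)
    (hpow : ∑ k, ((W k).trace).re ≤ P)
    (hpos : ∀ k, 0 < (star (h k) ⬝ᵥ ((W k) *ᵥ (h k))).re)
    (wbar : Fin K → Fin M → ℂ)
    (hwbar : ∀ k, wbar k =
      (((Real.sqrt ((star (h k) ⬝ᵥ ((W k) *ᵥ (h k))).re))⁻¹ : ℝ) : ℂ) • ((W k) *ᵥ (h k)))
    (Wbar : Fin K → Matrix (Fin M) (Fin M) ℂ)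
    (hWbar : ∀ k, Wbar k = vecMulVec (wbar k) (star (wbar k))) :
    (∀ k, (Wbar k).rank = 1) ∧
    (∀ k, star (h k) ⬝ᵥ ((Wbar k) *ᵥ (h k)) = star (h k) ⬝ᵥ ((W k) *ᵥ (h k)) ∧
      R ≤ (star (h k) ⬝ᵥ ((Wbar k) *ᵥ (h k))).re) ∧
    (∀ k, ∑ k' ∈ Finset.univ.erase k,
      (star (h k') ⬝ᵥ ((Wbar k) *ᵥ (h k'))).re ≤ ε) ∧
    (∑ k, ((Wbar k).trace).re ≤ P) := by
  have key : ∀ k x, star x ⬝ᵥ (Wbar k *ᵥ x) =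
      (((star (h k) ⬝ᵥ (W k *ᵥ h k)).re⁻¹ *
        Complex.normSq (star x ⬝ᵥ (W k *ᵥ h k)) : ℝ) : ℂ) := by
    intro k x
    rw [hWbar, aux_quad, hwbar, dotProduct_smul, smul_eq_mul, Complex.normSq_mul,
      Complex.normSq_ofReal, ← mul_inv, Real.mul_self_sqrt (hpos k).le]
  have le : ∀ k x, (star x ⬝ᵥ (Wbar k *ᵥ x)).re ≤ (star x ⬝ᵥ (W k *ᵥ x)).re := by
    intro k x
    rw [key, Complex.ofReal_re, inv_mul_le_iff₀ (hpos k)]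
    exact aux_cs (hW k) x (h k) (hpos k)
  have eq : ∀ k, star (h k) ⬝ᵥ (Wbar k *ᵥ h k) = star (h k) ⬝ᵥ (W k *ᵥ h k) := by
    intro k
    have hr := aux_real (hW k) (h k)
    have hp := hpos k
    rw [key]
    generalize star (h k) ⬝ᵥ (W k *ᵥ h k) = z at *
    rw [hr]
    norm_cast
    rw [Complex.normSq_ofReal]
    field_simp
  refine ⟨fun k => ?_, fun k => ⟨eq k, by rw [eq]; exact hgain k⟩, fun k => ?_, ?_⟩
  · apply le_antisymm
    · rw [hWbar]; exact Matrix.rank_vecMulVec_le _ _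
    · rw [Nat.one_le_iff_ne_zero]
      intro h0
      rw [Matrix.rank, Submodule.finrank_eq_zero, LinearMap.range_eq_bot] at h0
      have h1 : Wbar k *ᵥ h k = 0 := by
        rw [← Matrix.mulVecLin_apply, h0, LinearMap.zero_apply]
      have := hpos k
      rw [← eq, h1] at this
      simp at this
  · exact (Finset.sum_le_sum fun k' _ => le k (h k')).trans (hinterf k)
  · refine (Finset.sum_le_sum fun k _ => ?_).trans hpow
    rw [aux_trace, aux_trace]
    exact Finset.sum_le_sum fun i _ => le k _
end

section
/- Let W, W₀ ∈ ℂ^{M×M} and V, V₀ ∈ ℂ^{N×N} be Hermitian matrices, and let Q ∈ ℂ^{N×M}. Then Tr(W Q^H V Q) ≤ (1/2)‖W + Q^H V Q‖_F² + (1/2)‖W₀‖_F² − Re( Tr( W₀^H W ) ) + (1/2)‖Q^H V₀ Q‖_F² − Re( Tr( (Q Q^H V₀ Q Q^H)^H V ) ). -/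
open Matrix

/-- The squared Frobenius norm `‖A‖_F² = Tr(Aᴴ A)` of a complex matrix. -/
noncomputable def frobSq {m n : ℕ} (A : Matrix (Fin m) (Fin n) ℂ) : ℝ :=
  ((Aᴴ * A).trace).re

/-- Inequality (26): convex global upper bound `𝓕_ub` on the interference term
`Tr(W Qᴴ V Q)`, valid for any Hermitian reference points `W₀, V₀`. -/
theorem trace_bilinear_upper_bound
    {M N : ℕ} (W W₀ : Matrix (Fin M) (Fin M) ℂ) (V V₀ : Matrix (Fin N) (Fin N) ℂ)
    (hW : W.IsHermitian) (hW₀ : W₀.IsHermitian)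
    (hV : V.IsHermitian) (hV₀ : V₀.IsHermitian)
    (Q : Matrix (Fin N) (Fin M) ℂ) :
    ((W * (Qᴴ * V * Q)).trace).re ≤
      (1 / 2) * frobSq (W + Qᴴ * V * Q)
        + (1 / 2) * frobSq W₀ - ((W₀ᴴ * W).trace).re
        + (1 / 2) * frobSq (Qᴴ * V₀ * Q)
        - (((Q * Qᴴ * V₀ * Q * Qᴴ)ᴴ * V).trace).re := by
  have nn : ∀ A : Matrix (Fin M) (Fin M) ℂ, 0 ≤ ((Aᴴ * A).trace).re := by
    intro A
    open scoped ComplexOrder in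
    exact (Complex.le_def.mp (Matrix.posSemidef_conjTranspose_mul_self A).trace_nonneg).1
  have hB : (Qᴴ * V * Q)ᴴ = Qᴴ * V * Q := by
    simp [Matrix.conjTranspose_mul, hV.eq, Matrix.mul_assoc]
  have hB₀ : (Qᴴ * V₀ * Q)ᴴ = Qᴴ * V₀ * Q := by
    simp [Matrix.conjTranspose_mul, hV₀.eq, Matrix.mul_assoc]
  have hT : ((Q * Qᴴ * V₀ * Q * Qᴴ)ᴴ * V).trace = ((Qᴴ * V₀ * Q) * (Qᴴ * V * Q)).trace := by
    have h1 : (Q * Qᴴ * V₀ * Q * Qᴴ)ᴴ * V = Q * (Qᴴ * V₀ * Q * Qᴴ * V) := by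
      simp [Matrix.conjTranspose_mul, hV₀.eq, Matrix.mul_assoc]
    rw [h1, Matrix.trace_mul_comm]
    simp only [Matrix.mul_assoc]
  rw [hT]
  unfold frobSq
  generalize Qᴴ * V * Q = B at *
  generalize Qᴴ * V₀ * Q = B₀ at *
  have h1 := nn (W - W₀)
  have h2 := nn (B - B₀)
  have c1 := Matrix.trace_mul_comm W W₀
  have c2 := Matrix.trace_mul_comm B B₀
  have c3 := Matrix.trace_mul_comm B W
  simp only [Matrix.conjTranspose_sub, Matrix.conjTranspose_add, hW.eq, hW₀.eq, hB, hB₀,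
    Matrix.sub_mul, Matrix.mul_sub, Matrix.add_mul, Matrix.mul_add, Matrix.trace_sub,
    Matrix.trace_add, Complex.sub_re, Complex.add_re, c1, c2, c3] at h1 h2 ⊢
  linarith
end

section
/- Let h, h' ∈ ℂ^M with h ≠ 0, let p > 0 and ε ≥ 0, and suppose p |h'^H h|² ≤ ε ‖h‖². Then the vector w* = √p · h/‖h‖ satisfies ‖w*‖² ≤ p and |h'^H w*|² ≤ ε, and for every w ∈ ℂ^M with ‖w‖² ≤ p and |h'^H w|² ≤ ε one has |h^H w|² ≤ |h^H w*|² = p ‖h‖². That is, in the low-cross-channel regime the MRT beamformer is a global maximizer of the beam pattern gain under the power and interference constraints. -/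
open scoped ComplexInnerProductSpace

/-- First case of Proposition 2 (two-target SS sensing, low-cross-channel regime):
if `p |h'ᴴh|² ≤ ε ‖h‖²`, then the MRT beamformer `w* = √p · h/‖h‖` is feasible
(`‖w*‖² ≤ p`, `|h'ᴴw*|² ≤ ε`) and globally maximizes the beam pattern gain `|hᴴw|²`
subject to `‖w‖² ≤ p` and `|h'ᴴw|² ≤ ε`, attaining value `p‖h‖²`. Here `⟪x, y⟫` is the
complex inner product, conjugate-linear in `x`, so that `⟪x, y⟫ = xᴴ y`. -/
theorem mrt_optimal_low_interference
    {M : ℕ} (h h' : EuclideanSpace ℂ (Fin M)) (hh : h ≠ 0)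
    (p ε : ℝ) (hp : 0 < p) (hε : 0 ≤ ε)
    (hcase : p * ‖⟪h', h⟫‖ ^ 2 ≤ ε * ‖h‖ ^ 2)
    (wstar : EuclideanSpace ℂ (Fin M)) (hws : wstar = (Real.sqrt p / ‖h‖) • h) :
    ‖wstar‖ ^ 2 ≤ p ∧
    ‖⟪h', wstar⟫‖ ^ 2 ≤ ε ∧
    ‖⟪h, wstar⟫‖ ^ 2 = p * ‖h‖ ^ 2 ∧
    (∀ w : EuclideanSpace ℂ (Fin M), ‖w‖ ^ 2 ≤ p → ‖⟪h', w⟫‖ ^ 2 ≤ ε →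
      ‖⟪h, w⟫‖ ^ 2 ≤ ‖⟪h, wstar⟫‖ ^ 2) := by
  have hn : 0 < ‖h‖ := norm_pos_iff.mpr hh
  have hs : Real.sqrt p ^ 2 = p := Real.sq_sqrt hp.le
  have key : ∀ x : EuclideanSpace ℂ (Fin M),
      ‖⟪x, wstar⟫‖ ^ 2 = p / ‖h‖ ^ 2 * ‖⟪x, h⟫‖ ^ 2 := by
    intro x
    rw [hws, inner_smul_right_eq_smul, norm_smul, mul_pow, Real.norm_eq_abs, sq_abs, div_pow, hs]
  have hopt : ‖⟪h, wstar⟫‖ ^ 2 = p * ‖h‖ ^ 2 := by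
    have hself : ‖⟪h, h⟫‖ = ‖h‖ ^ 2 := by
      rw [inner_self_eq_norm_sq_to_K]
      simp
    rw [key, hself]
    field_simp
  refine ⟨?_, ?_, hopt, ?_⟩
  · rw [hws, norm_smul, mul_pow, Real.norm_eq_abs, sq_abs, div_pow, hs]
    apply le_of_eq
    field_simp
  · rw [key, div_mul_eq_mul_div, div_le_iff₀ (by positivity)]
    exact hcase
  · intro w hw _
    rw [hopt]
    calc ‖⟪h, w⟫‖ ^ 2 ≤ (‖h‖ * ‖w‖) ^ 2 := by
          gcongr
          exact norm_inner_le_norm h w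
      _ = ‖w‖ ^ 2 * ‖h‖ ^ 2 := by ring
      _ ≤ p * ‖h‖ ^ 2 := by gcongr
end

section
/- Let h, h' ∈ ℂ^M with h' ≠ 0, let p > 0 and ε ≥ 0, and suppose p |h'^H h|² > ε ‖h‖². Define g := h − (h'^H h / ‖h'‖²) h' and assume g ≠ 0 and h^H g ≠ 0. Let χ := conj(h^H g)/|h^H g|, ρ₁ := √ε / |h'^H h|, and ρ₂ := ( −ρ₁ |h^H g| + √( ρ₁² |h^H g|² − ‖g‖² (ρ₁² ‖h‖² − p) ) ) / ‖g‖². Then the vector w* := ρ₁ h + ρ₂ χ g satisfies ‖w*‖² = p and |h'^H w*|² = ε (note h'^H g = 0 and ρ₁² ‖h‖² < p, so ρ₂ is well defined and real), and for every w ∈ ℂ^M with ‖w‖² ≤ p and |h'^H w|² ≤ ε one has |h^H w|² ≤ |h^H w*|². That is, w* is a global maximizer of the two-target beam-pattern-gain problem, and the optimal beamformer lies in the span of h and its component g orthogonal to h'. -/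
open scoped ComplexInnerProductSpace

/-- Second (interference-limited) case of Proposition 2: closed-form optimal two-target
beamformer. With `g = h − (h'ᴴh/‖h'‖²) h'` the component of `h` orthogonal to `h'`,
`χ = conj(hᴴg)/|hᴴg|`, `ρ₁ = √ε/|h'ᴴh|`, and
`ρ₂ = (−ρ₁|hᴴg| + √(ρ₁²|hᴴg|² − ‖g‖²(ρ₁²‖h‖² − p)))/‖g‖²`, the beamformer
`w* = ρ₁ h + ρ₂ χ g` meets the power constraint with equality, the interference
constraint with equality, and globally maximizes `|hᴴw|²` over the feasible set.
Here `⟪x, y⟫` is the complex inner product, conjugate-linear in `x`, so `⟪x, y⟫ = xᴴ y`. -/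
theorem two_target_closed_form_optimal
    {M : ℕ} (h h' : EuclideanSpace ℂ (Fin M)) (hh' : h' ≠ 0)
    (p ε : ℝ) (hp : 0 < p) (hε : 0 ≤ ε)
    (hcase : ε * ‖h‖ ^ 2 < p * ‖⟪h', h⟫‖ ^ 2)
    (g : EuclideanSpace ℂ (Fin M))
    (hg : g = h - (⟪h', h⟫ / ((‖h'‖ : ℂ) ^ 2)) • h')
    (hgne : g ≠ 0) (hipne : ⟪h, g⟫ ≠ 0)
    (χ : ℂ) (hχ : χ = (starRingEnd ℂ) ⟪h, g⟫ / (‖⟪h, g⟫‖ : ℂ))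
    (ρ₁ ρ₂ : ℝ)
    (hρ₁ : ρ₁ = Real.sqrt ε / ‖⟪h', h⟫‖)
    (hρ₂ : ρ₂ = (-(ρ₁ * ‖⟪h, g⟫‖) +
        Real.sqrt (ρ₁ ^ 2 * ‖⟪h, g⟫‖ ^ 2 - ‖g‖ ^ 2 * (ρ₁ ^ 2 * ‖h‖ ^ 2 - p))) / ‖g‖ ^ 2)
    (wstar : EuclideanSpace ℂ (Fin M))
    (hws : wstar = (ρ₁ : ℂ) • h + ((ρ₂ : ℂ) * χ) • g) :
    ‖wstar‖ ^ 2 = p ∧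
    ‖⟪h', wstar⟫‖ ^ 2 = ε ∧
    (∀ w : EuclideanSpace ℂ (Fin M), ‖w‖ ^ 2 ≤ p → ‖⟪h', w⟫‖ ^ 2 ≤ ε →
      ‖⟪h, w⟫‖ ^ 2 ≤ ‖⟪h, wstar⟫‖ ^ 2) := by
  have ha : 0 < ‖⟪h', h⟫‖ := by
    rcases (norm_nonneg ⟪h', h⟫).eq_or_lt with h0 | h0
    · rw [← h0] at hcase
      nlinarith [mul_nonneg hε (sq_nonneg ‖h‖)]
    · exact h0
  have hN : 0 < ‖h'‖ := norm_pos_iff.mpr hh'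
  have hG : 0 < ‖g‖ := norm_pos_iff.mpr hgne
  have hNc : (‖h'‖ : ℂ) ≠ 0 := by exact_mod_cast hN.ne'
  obtain ⟨c, hc⟩ : ∃ c, c = ⟪h', h⟫ / ((‖h'‖ : ℂ) ^ 2) := ⟨_, rfl⟩
  rw [← hc] at hg
  have hcn : ‖c‖ * ‖h'‖ ^ 2 = ‖⟪h', h⟫‖ := by
    rw [hc, norm_div, norm_pow, Complex.norm_real, norm_norm]
    field_simp
  have horth : ⟪h', g⟫ = 0 := by
    rw [hg, inner_sub_right, inner_smul_right, inner_self_eq_norm_sq_to_K, hc]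
    simp only [Complex.coe_algebraMap]
    field_simp
    simp
  have horth' : ⟪g, h'⟫ = 0 := inner_eq_zero_symm.mp horth
  have hh : h = c • h' + g := by rw [hg]; abel
  have hhg : ⟪h, g⟫ = ((‖g‖ ^ 2 : ℝ) : ℂ) := by
    rw [hh, inner_add_left, inner_smul_left, horth, inner_self_eq_norm_sq_to_K]
    simp
  have hhgn : ‖⟪h, g⟫‖ = ‖g‖ ^ 2 := by
    rw [hhg, Complex.norm_real, Real.norm_of_nonneg (by positivity)]
  have hχ1 : χ = 1 := by
    rw [hχ, hhgn, hhg, Complex.conj_ofReal]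
    apply div_self
    exact_mod_cast (by positivity : ‖g‖ ^ 2 ≠ 0)
  have key : ∀ (x : ℂ) (y : ℝ), ‖x • h' + (y : ℂ) • g‖ ^ 2
      = ‖x‖ ^ 2 * ‖h'‖ ^ 2 + y ^ 2 * ‖g‖ ^ 2 := by
    intro x y
    have := norm_add_sq_eq_norm_sq_add_norm_sq_of_inner_eq_zero (𝕜 := ℂ) (x • h') ((y : ℂ) • g)
      (by rw [inner_smul_left, inner_smul_right, horth]; simp)
    rw [pow_two, this, norm_smul, norm_smul, Complex.norm_real, Real.norm_eq_abs]
    rw [← sq_abs y]; ring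
  have hH : ‖h‖ ^ 2 = ‖c‖ ^ 2 * ‖h'‖ ^ 2 + ‖g‖ ^ 2 := by
    have := key c 1
    rw [Complex.ofReal_one, one_smul, ← hh] at this
    linarith
  have hw : wstar = ((ρ₁ : ℂ) * c) • h' + ((ρ₁ + ρ₂ : ℝ) : ℂ) • g := by
    rw [hws, hχ1]
    nth_rewrite 1 [hh]
    push_cast
    module
  have hρ₁0 : 0 ≤ ρ₁ := by rw [hρ₁]; positivity
  have hρa : ρ₁ * ‖⟪h', h⟫‖ = √ε := by rw [hρ₁]; field_simp
  have hρH : ρ₁ ^ 2 * ‖h‖ ^ 2 < p := by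
    have h2 : ρ₁ ^ 2 * ‖⟪h', h⟫‖ ^ 2 = ε := by rw [← mul_pow, hρa, Real.sq_sqrt hε]
    rw [← h2] at hcase
    have : 0 < ‖⟪h', h⟫‖ ^ 2 := by positivity
    nlinarith
  rw [hhgn] at hρ₂
  obtain ⟨D, hD⟩ : ∃ D, D = ρ₁ ^ 2 * (‖g‖ ^ 2) ^ 2 - ‖g‖ ^ 2 * (ρ₁ ^ 2 * ‖h‖ ^ 2 - p) := ⟨_, rfl⟩
  rw [← hD] at hρ₂
  have hG2 : 0 < ‖g‖ ^ 2 := by positivity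
  have hDlt : (ρ₁ * ‖g‖ ^ 2) ^ 2 < D := by
    rw [hD]; nlinarith [mul_pos hG2 (sub_pos.mpr hρH)]
  have hD0 : 0 < D := lt_of_le_of_lt (sq_nonneg _) hDlt
  have hsG : (ρ₁ + ρ₂) * ‖g‖ ^ 2 = √D := by rw [hρ₂]; field_simp; ring
  have hρ₂0 : 0 ≤ ρ₂ := by
    have : ρ₁ * ‖g‖ ^ 2 ≤ √D := Real.le_sqrt_of_sq_le hDlt.le
    rw [hρ₂]
    apply div_nonneg _ hG2.le
    linarith
  have hs : 0 < ρ₁ + ρ₂ := by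
    have := Real.sqrt_pos.mpr hD0
    rw [← hsG] at this
    exact pos_of_mul_pos_left this hG2.le
  have hP : ρ₁ ^ 2 * (‖c‖ ^ 2 * ‖h'‖ ^ 2) + (ρ₁ + ρ₂) ^ 2 * ‖g‖ ^ 2 = p := by
    have h1 : ((ρ₁ + ρ₂) * ‖g‖ ^ 2) ^ 2 = D := by rw [hsG, Real.sq_sqrt hD0.le]
    rw [hD, hH] at h1
    apply mul_left_cancel₀ hG2.ne'
    linarith
  have hnorm : ‖wstar‖ ^ 2 = p := by
    rw [hw, key, norm_mul, Complex.norm_real, Real.norm_of_nonneg hρ₁0, ← hP]; ring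
  refine ⟨hnorm, ?_, ?_⟩
  · rw [hws, inner_add_right, inner_smul_right, inner_smul_right, horth, mul_zero, add_zero,
      norm_mul, Complex.norm_real, Real.norm_of_nonneg hρ₁0, hρa, Real.sq_sqrt hε]
  · intro w hwp hwε
    have hval : ⟪h, wstar⟫ = ((ρ₁ * ‖h‖ ^ 2 + ρ₂ * ‖g‖ ^ 2 : ℝ) : ℂ) := by
      rw [hws, hχ1, inner_add_right, inner_smul_right, inner_smul_right, hhg,
        inner_self_eq_norm_sq_to_K]
      simp
    have hvaln : ‖⟪h, wstar⟫‖ = ρ₁ * ‖h‖ ^ 2 + ρ₂ * ‖g‖ ^ 2 := by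
      rw [hval, Complex.norm_real, Real.norm_of_nonneg (by positivity)]
    have hdec : ((ρ₁ + ρ₂ : ℝ) : ℂ) • h = wstar + ((ρ₂ : ℂ) * c) • h' := by
      rw [hw, hh]; push_cast; module
    have hin : ((ρ₁ + ρ₂ : ℝ) : ℂ) * ⟪h, w⟫
        = ⟪wstar, w⟫ + (starRingEnd ℂ) ((ρ₂ : ℂ) * c) * ⟪h', w⟫ := by
      have := congrArg (fun v => ⟪v, w⟫) hdec
      simpa only [inner_add_left, inner_smul_left, Complex.conj_ofReal] using this
    have h1 : (ρ₁ + ρ₂) * ‖⟪h, w⟫‖ ≤ ‖⟪wstar, w⟫‖ + ρ₂ * ‖c‖ * ‖⟪h', w⟫‖ := by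
      have := congrArg norm hin
      rw [norm_mul, Complex.norm_real, Real.norm_of_nonneg hs.le] at this
      rw [this]
      refine (norm_add_le _ _).trans_eq ?_
      rw [norm_mul, RCLike.norm_conj, norm_mul, Complex.norm_real, Real.norm_of_nonneg hρ₂0]
    have h2 : ‖⟪wstar, w⟫‖ ≤ p := by
      have := norm_inner_le_norm (𝕜 := ℂ) wstar w
      nlinarith [sq_nonneg (‖wstar‖ - ‖w‖)]
    have h3 : ‖⟪h', w⟫‖ ≤ ρ₁ * (‖c‖ * ‖h'‖ ^ 2) := by
      rw [hcn, hρa]; exact Real.le_sqrt_of_sq_le hwε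
    have h4 : ρ₂ * ‖c‖ * ‖⟪h', w⟫‖ ≤ ρ₂ * ‖c‖ * (ρ₁ * (‖c‖ * ‖h'‖ ^ 2)) :=
      mul_le_mul_of_nonneg_left h3 (by positivity)
    have h5 : (ρ₁ + ρ₂) * ‖⟪h, w⟫‖ ≤ (ρ₁ + ρ₂) * ‖⟪h, wstar⟫‖ := by
      rw [hvaln, hH]
      refine (h1.trans (add_le_add h2 h4)).trans_eq ?_
      rw [← hP]; ring
    have h6 := le_of_mul_le_mul_left h5 hs
    gcongr
end
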